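/- Let σ > 0, let d be a positive integer, let μ, ν : Fin d → ℝ, and let α ∈ ℝ with α > 1. For x : Fin d → ℝ let P_μ(x) = ∏_{i} p_{μ i}(x i) and P_ν(x) = ∏_{i} p_{ν i}(x i), where p_c is the density of N(c, σ²) on ℝ. Then the integral over ℝ^d (with product Lebesgue measure) satisfies ∫ (P_μ x)^α · (P_ν x)^{1−α} dx = exp( α(α−1)·‖μ − ν‖² / (2σ²) ), where ‖μ − ν‖² = ∑_i (μ i − ν i)². (Privacy-loss moment of the d-dimensional spherical Gaussian mechanism, used for perturbing gradient vectors.) -/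

import Mathlib

open Real

/-- The probability density function of the real Gaussian distribution `N(μ, σ²)`. -/
noncomputable def gaussPDF (μ σ x : ℝ) : ℝ :=
  (1 / (σ * Real.sqrt (2 * Real.pi))) * Real.exp (-((x - μ) ^ 2) / (2 * σ ^ 2))

lemma gaussPDF_pos (μ : ℝ) {σ : ℝ} (hσ : 0 < σ) (x : ℝ) : 0 < gaussPDF μ σ x := by
  unfold gaussPDF
  positivity

lemma gaussPDF_eq_gaussianPDFReal (μ : ℝ) {σ : ℝ} (hσ : 0 < σ) :
    gaussPDF μ σ = ProbabilityTheory.gaussianPDFReal μ (σ ^ 2).toNNReal := by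
  ext x
  rw [gaussPDF, ProbabilityTheory.gaussianPDFReal, Real.coe_toNNReal _ (sq_nonneg σ),
    Real.sqrt_mul (x := 2 * Real.pi) (by positivity) (σ ^ 2), Real.sqrt_sq hσ.le, one_div, mul_comm σ]

lemma integral_gaussPDF (μ : ℝ) {σ : ℝ} (hσ : 0 < σ) : ∫ x, gaussPDF μ σ x = 1 := by
  rw [gaussPDF_eq_gaussianPDFReal μ hσ]
  exact ProbabilityTheory.integral_gaussianPDFReal_eq_one μ
    (Real.toNNReal_pos.mpr (by positivity)).ne'

/-- Geometric interpolation of two Gaussian densities of equal variance is a rescaled Gaussian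
density centred at the interpolated mean. -/
lemma gaussPDF_rpow_mul_gaussPDF_rpow (μ ν α : ℝ) {σ : ℝ} (hσ : 0 < σ) (x : ℝ) :
    gaussPDF μ σ x ^ α * gaussPDF ν σ x ^ (1 - α) =
      Real.exp (α * (α - 1) * (μ - ν) ^ 2 / (2 * σ ^ 2)) *
        gaussPDF (α * μ + (1 - α) * ν) σ x := by
  unfold gaussPDF
  have hC : 0 < 1 / (σ * Real.sqrt (2 * Real.pi)) := by positivity
  generalize 1 / (σ * Real.sqrt (2 * Real.pi)) = C at hC
  rw [Real.mul_rpow hC.le (Real.exp_pos _).le, Real.mul_rpow hC.le (Real.exp_pos _).le,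
    ← Real.exp_mul, ← Real.exp_mul, mul_mul_mul_comm, ← Real.rpow_add hC, ← Real.exp_add,
    mul_left_comm, ← Real.exp_add, add_sub_cancel, Real.rpow_one]
  congr 2
  field_simp
  ring

/-- privacy-loss moment of the `d`-dimensional spherical Gaussian
mechanism: with `P_μ(x) = ∏ i, p_{μ i}(x i)` and `P_ν(x) = ∏ i, p_{ν i}(x i)`,
`∫ P_μ^α P_ν^{1-α} = exp(α(α-1)‖μ-ν‖²/(2σ²))` where `‖μ-ν‖² = ∑ i, (μ i - ν i)²`. -/
theorem gaussian_vector_renyi_moment (σ : ℝ) (hσ : 0 < σ) (d : ℕ) (hd : 0 < d)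
    (μ ν : Fin d → ℝ) (α : ℝ) (hα : 1 < α) :
    ∫ x : Fin d → ℝ,
        (∏ i, gaussPDF (μ i) σ (x i)) ^ α * (∏ i, gaussPDF (ν i) σ (x i)) ^ (1 - α)
      = Real.exp (α * (α - 1) * (∑ i, (μ i - ν i) ^ 2) / (2 * σ ^ 2)) := by
  have h (x : Fin d → ℝ) :
      (∏ i, gaussPDF (μ i) σ (x i)) ^ α * (∏ i, gaussPDF (ν i) σ (x i)) ^ (1 - α) =
        ∏ i, Real.exp (α * (α - 1) * (μ i - ν i) ^ 2 / (2 * σ ^ 2)) *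
          gaussPDF (α * μ i + (1 - α) * ν i) σ (x i) := by
    rw [← Real.finsetProd_rpow _ _ fun i _ ↦ (gaussPDF_pos _ hσ _).le,
      ← Real.finsetProd_rpow _ _ fun i _ ↦ (gaussPDF_pos _ hσ _).le, ← Finset.prod_mul_distrib]
    exact Finset.prod_congr rfl fun i _ ↦ gaussPDF_rpow_mul_gaussPDF_rpow _ _ _ hσ _
  simp_rw [h]
  rw [MeasureTheory.integral_fintype_prod_volume_eq_prod (fun i y ↦
    Real.exp (α * (α - 1) * (μ i - ν i) ^ 2 / (2 * σ ^ 2)) *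
      gaussPDF (α * μ i + (1 - α) * ν i) σ y)]
  simp_rw [MeasureTheory.integral_const_mul, integral_gaussPDF _ hσ, mul_one]
  rw [← Real.exp_sum, Finset.mul_sum, Finset.sum_div]
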